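/- Let ε = exp(2πi/5) and let 2I be the binary icosahedral group Δ'(2,3,5), the subgroup of SL₂(ℂ) generated by S = [[ε³,0],[0,ε²]] and T = (1/√5)·[[−(ε−ε⁴), ε²−ε³],[ε²−ε³, ε−ε⁴]], acting on ℂ[x,y] by linear substitution of the variables. Then the invariant subalgebra ℂ[x,y]^{2I} is isomorphic as a ℂ-algebra to ℂ[z₁,z₂,z₃]/(z₁² + z₂³ + z₃⁵), the coordinate ring of the Brieskorn variety V(2,3,5). Hence V(2,3,5) ≅ ℂ²/Δ'(2,3,5) (Klein's theorem). -/

import Mathlib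

open MvPolynomial

/-- The ℂ-algebra endomorphism of `ℂ[x,y]` given by the linear substitution of variables by an
invertible 2×2 matrix `M`: `x_i ↦ Σ_j M i j · x_j`. -/
noncomputable def linSubst (M : Matrix (Fin 2) (Fin 2) ℂ) :
    MvPolynomial (Fin 2) ℂ →ₐ[ℂ] MvPolynomial (Fin 2) ℂ :=
  aeval fun i => ∑ j, C (M i j) * X j

/-- The subalgebra of `ℂ[x,y]` of polynomials invariant under linear substitution by all
matrices in a subgroup `G` of `GL₂(ℂ)`. -/
noncomputable def invariantSubalgebra (G : Subgroup (Matrix (Fin 2) (Fin 2) ℂ)ˣ) :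
    Subalgebra ℂ (MvPolynomial (Fin 2) ℂ) :=
  ⨅ u ∈ G, AlgHom.equalizer (linSubst (u : Matrix (Fin 2) (Fin 2) ℂ))
    (AlgHom.id ℂ (MvPolynomial (Fin 2) ℂ))

/-- Klein's invariant form of degree 12. -/
def icosaVertexForm {R : Type*} [CommRing R] (x y : R) : R :=
  x * y * (x ^ 10 + 11 * x ^ 5 * y ^ 5 - y ^ 10)

/-- Klein's invariant form of degree 20. -/
def icosaFaceForm {R : Type*} [CommRing R] (x y : R) : R :=
  -(x ^ 20 + y ^ 20) + 228 * (x ^ 15 * y ^ 5 - x ^ 5 * y ^ 15) - 494 * x ^ 10 * y ^ 10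

/-- Klein's invariant form of degree 30. -/
def icosaEdgeForm {R : Type*} [CommRing R] (x y : R) : R :=
  x ^ 30 + y ^ 30 + 522 * (x ^ 25 * y ^ 5 - x ^ 5 * y ^ 25)
    - 10005 * (x ^ 20 * y ^ 10 + x ^ 10 * y ^ 20)

section Forms

variable {R : Type*} [CommRing R]

theorem icosaForms_syzygy (x y : R) :
    icosaEdgeForm x y ^ 2 + icosaFaceForm x y ^ 3 = 1728 * icosaVertexForm x y ^ 5 := by
  unfold icosaEdgeForm icosaFaceForm icosaVertexForm
  ring

theorem icosaVertexForm_eq (x y : R) :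
    icosaVertexForm x y = (x * y) * ((x ^ 2 - y ^ 2) ^ 5 + 5 * (x ^ 2 - y ^ 2) ^ 3 * (x * y) ^ 2
      + 5 * (x ^ 2 - y ^ 2) * (x * y) ^ 4 + 11 * (x * y) ^ 5) := by
  unfold icosaVertexForm
  ring

theorem icosaFaceForm_eq (x y : R) :
    icosaFaceForm x y =
      -((x ^ 2 - y ^ 2) ^ 10 + 10 * (x ^ 2 - y ^ 2) ^ 8 * (x * y) ^ 2
        + 35 * (x ^ 2 - y ^ 2) ^ 6 * (x * y) ^ 4 + 50 * (x ^ 2 - y ^ 2) ^ 4 * (x * y) ^ 6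
        + 25 * (x ^ 2 - y ^ 2) ^ 2 * (x * y) ^ 8 + 2 * (x * y) ^ 10)
      + 228 * (x * y) ^ 5 * ((x ^ 2 - y ^ 2) ^ 5 + 5 * (x ^ 2 - y ^ 2) ^ 3 * (x * y) ^ 2
        + 5 * (x ^ 2 - y ^ 2) * (x * y) ^ 4)
      - 494 * (x * y) ^ 10 := by
  unfold icosaFaceForm
  ring

theorem icosaEdgeForm_eq (x y : R) :
    icosaEdgeForm x y =
      (x ^ 2 + y ^ 2) *
      (((x ^ 2 - y ^ 2) ^ 4 + 3 * (x ^ 2 - y ^ 2) ^ 2 * (x * y) ^ 2 + (x * y) ^ 4) *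
      (((x ^ 2 - y ^ 2) ^ 5 + 5 * (x ^ 2 - y ^ 2) ^ 3 * (x * y) ^ 2
        + 5 * (x ^ 2 - y ^ 2) * (x * y) ^ 4) ^ 2
      + 522 * (x * y) ^ 5 * ((x ^ 2 - y ^ 2) ^ 5 + 5 * (x ^ 2 - y ^ 2) ^ 3 * (x * y) ^ 2
        + 5 * (x ^ 2 - y ^ 2) * (x * y) ^ 4) - 10004 * (x * y) ^ 10)) := by
  unfold icosaEdgeForm
  ring

variable {a b d : R} (hab : a * b = d) (hba : b ^ 2 - a ^ 2 = d) (hs : a ^ 2 + b ^ 2 = -1)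
  (hd : 5 * d ^ 2 = 1)

include hab hba in
theorem sq_sub_sq_reflect (x y : R) :
    (a * x + b * y) ^ 2 - (b * x - a * y) ^ 2 = d * (4 * (x * y) - (x ^ 2 - y ^ 2)) := by
  linear_combination (4 * x * y) * hab - (x ^ 2 - y ^ 2) * hba

include hab hba in
theorem mul_reflect (x y : R) :
    (a * x + b * y) * (b * x - a * y) = d * ((x ^ 2 - y ^ 2) + x * y) := by
  linear_combination (x ^ 2 - y ^ 2) * hab + x * y * hba

include hs in
theorem sq_add_sq_reflect (x y : R) :
    (a * x + b * y) ^ 2 + (b * x - a * y) ^ 2 = -(x ^ 2 + y ^ 2) := by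
  linear_combination (x ^ 2 + y ^ 2) * hs

include hab hba hd in
theorem icosaVertexForm_reflect (x y : R) :
    icosaVertexForm (a * x + b * y) (b * x - a * y) = icosaVertexForm x y := by
  rw [icosaVertexForm_eq, icosaVertexForm_eq x y, sq_sub_sq_reflect hab hba, mul_reflect hab hba]
  generalize x ^ 2 - y ^ 2 = s
  generalize x * y = w
  have h : 5 ^ 3 * d ^ 6 = 1 := by
    calc 5 ^ 3 * d ^ 6 = (5 * d ^ 2) ^ 3 := by ring
      _ = 1 := by rw [hd, one_pow]
  linear_combination (w * (s ^ 5 + 5 * s ^ 3 * w ^ 2 + 5 * s * w ^ 4 + 11 * w ^ 5)) * h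

include hab hba hd in
theorem icosaFaceForm_reflect (x y : R) :
    icosaFaceForm (a * x + b * y) (b * x - a * y) = icosaFaceForm x y := by
  rw [icosaFaceForm_eq, icosaFaceForm_eq x y, sq_sub_sq_reflect hab hba, mul_reflect hab hba]
  generalize x ^ 2 - y ^ 2 = s
  generalize x * y = w
  have h : 5 ^ 5 * d ^ 10 = 1 := by
    calc 5 ^ 5 * d ^ 10 = (5 * d ^ 2) ^ 5 := by ring
      _ = 1 := by rw [hd, one_pow]
  linear_combination (-(s ^ 10 + 10 * s ^ 8 * w ^ 2 + 35 * s ^ 6 * w ^ 4 + 50 * s ^ 4 * w ^ 6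
    + 25 * s ^ 2 * w ^ 8 + 2 * w ^ 10) + 228 * w ^ 5 * (s ^ 5 + 5 * s ^ 3 * w ^ 2 + 5 * s * w ^ 4)
    - 494 * w ^ 10) * h

include hab hba hs hd in
theorem icosaEdgeForm_reflect (x y : R) :
    icosaEdgeForm (a * x + b * y) (b * x - a * y) = icosaEdgeForm x y := by
  rw [icosaEdgeForm_eq, icosaEdgeForm_eq x y, sq_sub_sq_reflect hab hba, mul_reflect hab hba,
    sq_add_sq_reflect hs, neg_mul, ← mul_neg]
  congr 1
  generalize x ^ 2 - y ^ 2 = s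
  generalize x * y = w
  have h : 5 ^ 7 * d ^ 14 = 1 := by
    calc 5 ^ 7 * d ^ 14 = (5 * d ^ 2) ^ 7 := by ring
      _ = 1 := by rw [hd, one_pow]
  linear_combination ((s ^ 4 + 3 * s ^ 2 * w ^ 2 + w ^ 4) *
    ((s ^ 5 + 5 * s ^ 3 * w ^ 2 + 5 * s * w ^ 4) ^ 2
      + 522 * w ^ 5 * (s ^ 5 + 5 * s ^ 3 * w ^ 2 + 5 * s * w ^ 4) - 10004 * w ^ 10)) * h

end Forms

section Homogeneous

variable {σ R : Type*} [CommRing R]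

theorem MvPolynomial.IsHomogeneous.eval_smul {P : MvPolynomial σ R} {n : ℕ}
    (hP : P.IsHomogeneous n) (c : R) (v : σ → R) : eval (c • v) P = c ^ n * eval v P := by
  rw [eval_eq, eval_eq, Finset.mul_sum]
  refine Finset.sum_congr rfl fun m hm => ?_
  have hn : ∑ i ∈ m.support, m i = n := (hP.degree_eq_sum_deg_support hm).symm
  simp only [Pi.smul_apply, smul_eq_mul, mul_pow, Finset.prod_mul_distrib,
    Finset.prod_pow_eq_pow_sum, hn]
  ring

theorem MvPolynomial.homogeneousComponent_mul_of_isHomogeneous {P : MvPolynomial σ R} {m : ℕ}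
    (hP : P.IsHomogeneous m) (Q : MvPolynomial σ R) (n : ℕ) :
    homogeneousComponent n (P * Q) = if m ≤ n then P * homogeneousComponent (n - m) Q else 0 := by
  classical
  conv_lhs => rw [← sum_homogeneousComponent Q, Finset.mul_sum, map_sum]
  have key : ∀ i, homogeneousComponent n (P * homogeneousComponent i Q) =
      if i + m = n then P * homogeneousComponent i Q else 0 := fun i => by
    rw [homogeneousComponent_of_mem
      (hP.mul (homogeneousComponent_isHomogeneous i Q)), add_comm]
    simp only [eq_comm]
  simp only [key]
  split_ifs with h
  · have : ∀ i, i + m = n ↔ i = n - m := fun i => by omega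
    simp only [this, Finset.sum_ite_eq', Finset.mem_range]
    split_ifs with h'
    · rfl
    · rw [homogeneousComponent_eq_zero _ _ (by omega), mul_zero]
  · exact Finset.sum_eq_zero fun i _ => if_neg (by omega)

theorem MvPolynomial.IsHomogeneous.exists_of_dvd {P F : MvPolynomial σ R} {m n : ℕ}
    (hP : P.IsHomogeneous n) (hF : F.IsHomogeneous m) (h : F ∣ P) :
    P = 0 ∨ m ≤ n ∧ ∃ Q : MvPolynomial σ R, Q.IsHomogeneous (n - m) ∧ P = F * Q := by
  obtain ⟨Q, rfl⟩ := h
  have h := homogeneousComponent_mul_of_isHomogeneous hF Q n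
  rw [homogeneousComponent_eq_self hP] at h
  split_ifs at h with hmn
  · exact Or.inr ⟨hmn, _, homogeneousComponent_isHomogeneous _ _, h⟩
  · exact Or.inl h

end Homogeneous

section BinaryForms

theorem MvPolynomial.X_one_dvd_sub_aeval {R : Type*} [CommRing R] (P : MvPolynomial (Fin 2) R) :
    (X 1 : MvPolynomial (Fin 2) R) ∣ P - aeval ![X 0, 0] P := by
  induction P using MvPolynomial.induction_on with
  | C a => simp
  | add p q hp hq =>
    rw [map_add, add_sub_add_comm]
    exact dvd_add hp hq
  | mul_X p i hp =>
    fin_cases i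
    · simpa [← sub_mul] using Dvd.dvd.mul_right hp _
    · simp

theorem MvPolynomial.X_one_dvd_of_eval_eq_zero {K : Type*} [CommRing K] [IsDomain K] [Infinite K]
    {P : MvPolynomial (Fin 2) K} (h : ∀ x, eval ![x, 0] P = 0) :
    (X 1 : MvPolynomial (Fin 2) K) ∣ P := by
  have h0 : aeval ![X 0, 0] P = (0 : MvPolynomial (Fin 2) K) := by
    refine MvPolynomial.funext fun v => ?_
    have hc : eval v (aeval ![X 0, 0] P) = eval ![v 0, 0] P := by
      rw [← coe_aeval_eq_eval, ← coe_aeval_eq_eval, RingHom.coe_coe, RingHom.coe_coe,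
        ← AlgHom.comp_apply]
      congr 1
      ext i
      fin_cases i <;> simp
    rw [hc, h, map_zero]
  have := X_one_dvd_sub_aeval P
  rwa [h0, sub_zero] at this

theorem MvPolynomial.IsHomogeneous.X_one_dvd {K : Type*} [CommRing K] [IsDomain K] [Infinite K]
    {P : MvPolynomial (Fin 2) K} {n : ℕ} (hP : P.IsHomogeneous n) (h : eval ![1, 0] P = 0) :
    (X 1 : MvPolynomial (Fin 2) K) ∣ P :=
  X_one_dvd_of_eval_eq_zero fun x => by
    have := hP.eval_smul x ![1, 0]
    rwa [h, mul_zero, Matrix.smul_cons, Matrix.smul_cons, smul_eq_mul, mul_one, smul_zero,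
      Matrix.smul_empty] at this

theorem isRelPrime_X_zero_X_one {R : Type*} [CommRing R] [IsDomain R] :
    IsRelPrime (X 0 : MvPolynomial (Fin 2) R) (X 1) :=
  (X_prime.irreducible.isRelPrime_iff_not_dvd).2 (by simp [X_dvd_X])

theorem isRelPrime_X_sub_C_mul_X {K : Type*} [Field K] {c c' : K} (h : c ≠ c') (n : ℕ) :
    IsRelPrime (X 0 ^ n - C c * X 1 ^ n : MvPolynomial (Fin 2) K) (X 0 ^ n - C c' * X 1 ^ n) := by
  intro d hd hd'
  have hu : IsUnit (C (c' - c) : MvPolynomial (Fin 2) K) :=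
    (isUnit_iff_ne_zero.2 (sub_ne_zero.2 h.symm)).map C
  have h1 : d ∣ X 1 ^ n := by
    have := dvd_sub hd hd'
    rw [show (X 0 ^ n - C c * X 1 ^ n - (X 0 ^ n - C c' * X 1 ^ n) : MvPolynomial (Fin 2) K)
      = C (c' - c) * X 1 ^ n by rw [C_sub]; ring] at this
    exact hu.dvd_mul_left.1 this
  have h0 : d ∣ X 0 ^ n := by
    have := dvd_add hd (Dvd.dvd.mul_left h1 (C c))
    rwa [sub_add_cancel] at this
  exact isRelPrime_X_zero_X_one.pow h0 h1

theorem isRelPrime_X_one_pow_sub {K : Type*} [Field K] (c : K) (n : ℕ) :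
    IsRelPrime (X 1 : MvPolynomial (Fin 2) K) (X 0 ^ (n + 1) - C c * X 1 ^ (n + 1)) := by
  intro d hd hd'
  have h0 := dvd_add hd' (Dvd.dvd.mul_left (dvd_pow hd n.succ_ne_zero) (C c))
  rw [sub_add_cancel] at h0
  exact isRelPrime_X_zero_X_one.pow_left h0 hd

theorem isRelPrime_X_zero_pow_sub {K : Type*} [Field K] {c : K} (hc : c ≠ 0) (n : ℕ) :
    IsRelPrime (X 0 : MvPolynomial (Fin 2) K) (X 0 ^ (n + 1) - C c * X 1 ^ (n + 1)) := by
  intro d hd hd'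
  have hu : IsUnit (C c : MvPolynomial (Fin 2) K) := (isUnit_iff_ne_zero.2 hc).map C
  have h0 := dvd_sub (dvd_pow hd n.succ_ne_zero) hd'
  rw [sub_sub_cancel, hu.dvd_mul_left] at h0
  exact isRelPrime_X_zero_X_one.pow_right hd h0

theorem pow_sub_C_mul_pow_dvd {K : Type*} [Field K] {ζ : K} {n : ℕ} (hn : 0 < n)
    (hζ : IsPrimitiveRoot ζ n) {c : K} (hc : c ≠ 0) {P : MvPolynomial (Fin 2) K}
    (h : ∀ k : ℕ, (X 0 - C (ζ ^ k * c) * X 1 : MvPolynomial (Fin 2) K) ∣ P) :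
    (X 0 ^ n - C (c ^ n) * X 1 ^ n : MvPolynomial (Fin 2) K) ∣ P := by
  have hprod : (X 0 ^ n - C (c ^ n) * X 1 ^ n : MvPolynomial (Fin 2) K) =
      ∏ k ∈ Finset.range n, (X 0 - C (ζ ^ k * c) * X 1) := by
    have hζ' := hζ.map_of_injective (C_injective (Fin 2) K)
    have := hζ'.pow_sub_pow_eq_prod_sub_mul (X 0) (C c * X 1) hn
    rw [C_pow, ← mul_pow, this]
    symm
    refine Finset.prod_bij (fun k _ => C ζ ^ k) (fun k _ => ?_) (fun i hi j hj hij => ?_)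
      (fun z hz => ?_) (fun k _ => ?_)
    · rw [Polynomial.mem_nthRootsFinset hn, ← pow_mul, mul_comm, pow_mul, hζ'.pow_eq_one, one_pow]
    · exact hζ'.pow_inj (Finset.mem_range.1 hi) (Finset.mem_range.1 hj) hij
    · rw [Polynomial.mem_nthRootsFinset hn] at hz
      have : NeZero n := ⟨hn.ne'⟩
      obtain ⟨i, hi, rfl⟩ := hζ'.eq_pow_of_pow_eq_one hz
      exact ⟨i, Finset.mem_range.2 hi, rfl⟩
    · rw [C_mul, C_pow, mul_assoc]
  rw [hprod]
  refine Finset.prod_dvd_of_isRelPrime (fun i hi j hj hij => ?_) fun k _ => h k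
  have hne : ζ ^ i * c ≠ ζ ^ j * c := fun e => hij <| hζ.pow_inj (Finset.mem_range.1 hi)
    (Finset.mem_range.1 hj) (mul_right_cancel₀ hc e)
  simpa [Function.onFun] using isRelPrime_X_sub_C_mul_X hne 1

end BinaryForms

section Relations

theorem eval_aeval_pair {σ R : Type*} [CommRing R] (v : σ → R) (H F : MvPolynomial σ R)
    (P : MvPolynomial (Fin 2) R) : eval v (aeval ![H, F] P) = eval ![eval v H, eval v F] P := by
  rw [← coe_aeval_eq_eval, ← coe_aeval_eq_eval, RingHom.coe_coe, RingHom.coe_coe,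
    ← AlgHom.comp_apply]
  congr 1
  ext i
  fin_cases i <;> simp

theorem algebraicIndependent_of_surjective_on_axis {K : Type*} [Field K] [Infinite K]
    {H F : MvPolynomial (Fin 2) K} (hF : F ≠ 0) (hF0 : ∀ x, eval ![x, 0] F = 0)
    (hH : ∀ s, ∃ x, eval ![x, 0] H = s) : AlgebraicIndependent K ![H, F] := by
  refine (injective_iff_map_eq_zero _).2 fun P => ?_
  induction hn : P.totalDegree using Nat.strong_induction_on generalizing P with
  | _ n ih =>
  intro hP
  obtain ⟨Q, rfl⟩ : X 1 ∣ P := X_one_dvd_of_eval_eq_zero fun s => by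
    obtain ⟨x, rfl⟩ := hH s
    have := eval_aeval_pair ![x, 0] H F P
    rwa [hP, map_zero, hF0, eq_comm] at this
  by_contra hQ
  have hQ0 : Q ≠ 0 := right_ne_zero_of_mul hQ
  rw [totalDegree_mul_of_isDomain (X_ne_zero _) hQ0, totalDegree_X] at hn
  rw [map_mul, aeval_X, Matrix.cons_val_one, Matrix.cons_val_zero, mul_eq_zero] at hP
  exact hQ0 (ih Q.totalDegree (by omega) Q rfl (hP.resolve_left hF))

/-- The coordinate ring of `z₁² + z₂³ + z₃⁵ = 0` is generated by `1` and `z₁` over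
`ℂ[z₂, z₃]`. -/
theorem exists_sub_mem_span_brieskorn {R : Type*} [CommRing R] (P : MvPolynomial (Fin 3) R) :
    ∃ A B : MvPolynomial (Fin 2) R,
      P - (aeval ![X 1, X 2] A + X 0 * aeval ![X 1, X 2] B) ∈
        Ideal.span {(X 0 ^ 2 + X 1 ^ 3 + X 2 ^ 5 : MvPolynomial (Fin 3) R)} := by
  simp only [Ideal.mem_span_singleton]
  induction P using MvPolynomial.induction_on with
  | C a => exact ⟨C a, 0, by simp [algebraMap_eq]⟩
  | add p q hp hq =>
    obtain ⟨A, B, h⟩ := hp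
    obtain ⟨A', B', h'⟩ := hq
    refine ⟨A + A', B + B', ?_⟩
    convert dvd_add h h' using 1
    simp only [map_add]
    ring
  | mul_X p i hp =>
    obtain ⟨A, B, h⟩ := hp
    fin_cases i
    · refine ⟨-(B * (X 0 ^ 3 + X 1 ^ 5)), A, ?_⟩
      convert dvd_add (h.mul_right (X 0)) (dvd_mul_right (X 0 ^ 2 + X 1 ^ 3 + X 2 ^ 5)
        (aeval ![X 1, X 2] B)) using 1
      simp only [map_neg, map_mul, map_add, map_pow, aeval_X, Matrix.cons_val_zero,
        Matrix.cons_val_one, Fin.zero_eta]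
      ring
    · refine ⟨A * X 0, B * X 0, ?_⟩
      convert h.mul_right (X 1) using 1
      simp only [map_mul, aeval_X, Matrix.cons_val_zero, Fin.mk_one]
      ring
    · refine ⟨A * X 1, B * X 1, ?_⟩
      convert h.mul_right (X 2) using 1
      simp only [map_mul, aeval_X, Matrix.cons_val_one, Matrix.cons_val_zero, Fin.reduceFinMk]
      ring

theorem ker_aeval_eq_span_brieskorn {K S : Type*} [Field K] [CharZero K] [CommRing S] [IsDomain S]
    [Algebra K S] {E H F : S} (hE : E ≠ 0) (hHF : AlgebraicIndependent K ![H, F])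
    (hrel : E ^ 2 + H ^ 3 + F ^ 5 = 0) (τ : S →ₐ[K] S) (hτE : τ E = -E) (hτH : τ H = H)
    (hτF : τ F = F) :
    RingHom.ker (aeval ![E, H, F] : MvPolynomial (Fin 3) K →ₐ[K] S) =
      Ideal.span {(X 0 ^ 2 + X 1 ^ 3 + X 2 ^ 5 : MvPolynomial (Fin 3) K)} := by
  have hle : Ideal.span {(X 0 ^ 2 + X 1 ^ 3 + X 2 ^ 5 : MvPolynomial (Fin 3) K)} ≤
      RingHom.ker (aeval ![E, H, F] : MvPolynomial (Fin 3) K →ₐ[K] S) := by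
    rw [Ideal.span_singleton_le_iff_mem, RingHom.mem_ker]
    simpa using hrel
  refine le_antisymm (fun P hP => ?_) hle
  obtain ⟨A, B, h⟩ := exists_sub_mem_span_brieskorn P
  have hcomp : ∀ Q : MvPolynomial (Fin 2) K,
      aeval ![E, H, F] (aeval ![X 1, X 2] Q : MvPolynomial (Fin 3) K) = aeval ![H, F] Q := by
    intro Q
    rw [← AlgHom.comp_apply]
    congr 1
    ext i
    fin_cases i <;> simp
  have hτ : ∀ Q : MvPolynomial (Fin 2) K, τ (aeval ![H, F] Q) = aeval ![H, F] Q := by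
    intro Q
    rw [← AlgHom.comp_apply]
    congr 1
    ext i
    fin_cases i <;> simp [hτH, hτF]
  have h1 := hle h
  rw [RingHom.mem_ker] at hP h1
  rw [map_sub, hP, zero_sub, neg_eq_zero, map_add, map_mul, hcomp, hcomp, aeval_X,
    Matrix.cons_val_zero] at h1
  have h2 := congrArg τ h1
  rw [map_add, map_mul, hτ, hτ, hτE, map_zero] at h2
  have : CharZero S := charZero_of_injective_algebraMap (algebraMap K S).injective
  have hA : aeval ![H, F] A = 0 := by
    have : (2 : S) * aeval ![H, F] A = 0 := by linear_combination h1 + h2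
    exact (mul_eq_zero.1 this).resolve_left two_ne_zero
  have hB : aeval ![H, F] B = 0 := by
    rw [hA, zero_add] at h1
    exact (mul_eq_zero.1 h1).resolve_left hE
  have hA0 : A = 0 := (injective_iff_map_eq_zero _).1 hHF A hA
  have hB0 : B = 0 := (injective_iff_map_eq_zero _).1 hHF B hB
  simpa [hA0, hB0] using h

end Relations

section LinSubst

theorem linSubst_X (M : Matrix (Fin 2) (Fin 2) ℂ) (i : Fin 2) :
    linSubst M (X i) = C (M i 0) * X 0 + C (M i 1) * X 1 := by
  simp [linSubst, Fin.sum_univ_two]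

theorem linSubst_C (M : Matrix (Fin 2) (Fin 2) ℂ) (c : ℂ) : linSubst M (C c) = C c :=
  (linSubst M).commutes c

theorem linSubst_one (P : MvPolynomial (Fin 2) ℂ) : linSubst 1 P = P := by
  have : linSubst 1 = AlgHom.id ℂ _ := by
    ext i
    fin_cases i <;> simp [linSubst_X]
  rw [this, AlgHom.id_apply]

theorem linSubst_mul (M N : Matrix (Fin 2) (Fin 2) ℂ) (P : MvPolynomial (Fin 2) ℂ) :
    linSubst (M * N) P = linSubst N (linSubst M P) := by
  have : linSubst (M * N) = (linSubst N).comp (linSubst M) := by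
    refine MvPolynomial.algHom_ext fun i => ?_
    simp only [AlgHom.comp_apply, linSubst_X, map_add, map_mul, linSubst_C, Matrix.mul_apply,
      Fin.sum_univ_two]
    ring
  rw [this, AlgHom.comp_apply]

theorem eval_linSubst (M : Matrix (Fin 2) (Fin 2) ℂ) (P : MvPolynomial (Fin 2) ℂ)
    (v : Fin 2 → ℂ) : eval v (linSubst M P) = eval (M.mulVec v) P := by
  rw [← coe_aeval_eq_eval, ← coe_aeval_eq_eval, RingHom.coe_coe, RingHom.coe_coe,
    ← AlgHom.comp_apply]
  congr 1
  refine MvPolynomial.algHom_ext fun i => ?_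
  rw [AlgHom.comp_apply, linSubst_X]
  simp [Matrix.mulVec, dotProduct, Fin.sum_univ_two, -Matrix.mulVec_fin_two]

theorem MvPolynomial.IsHomogeneous.linSubst {P : MvPolynomial (Fin 2) ℂ} {n : ℕ}
    (hP : P.IsHomogeneous n) (M : Matrix (Fin 2) (Fin 2) ℂ) :
    (linSubst M P).IsHomogeneous n := by
  rw [← one_mul n]
  exact hP.aeval _ fun i => IsHomogeneous.sum _ _ _ fun j _ => isHomogeneous_C_mul_X _ _

theorem homogeneousComponent_linSubst (M : Matrix (Fin 2) (Fin 2) ℂ)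
    (P : MvPolynomial (Fin 2) ℂ) (n : ℕ) :
    homogeneousComponent n (linSubst M P) = linSubst M (homogeneousComponent n P) := by
  conv_lhs => rw [← sum_homogeneousComponent P, map_sum, map_sum]
  have key : ∀ i, homogeneousComponent n (linSubst M (homogeneousComponent i P)) =
      if i = n then linSubst M (homogeneousComponent i P) else 0 := fun i => by
    rw [homogeneousComponent_of_mem ((homogeneousComponent_isHomogeneous i P).linSubst M)]
    simp only [eq_comm]
  simp only [key, Finset.sum_ite_eq', Finset.mem_range]
  split_ifs with h
  · rfl
  · rw [homogeneousComponent_eq_zero _ _ (by omega), map_zero]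

theorem mem_invariantSubalgebra {G : Subgroup (Matrix (Fin 2) (Fin 2) ℂ)ˣ}
    {P : MvPolynomial (Fin 2) ℂ} :
    P ∈ invariantSubalgebra G ↔ ∀ u ∈ G, linSubst (u : Matrix (Fin 2) (Fin 2) ℂ) P = P := by
  simp [invariantSubalgebra, Algebra.mem_iInf, AlgHom.mem_equalizer]

theorem mem_invariantSubalgebra_closure {s : Set (Matrix (Fin 2) (Fin 2) ℂ)ˣ}
    {P : MvPolynomial (Fin 2) ℂ} :
    P ∈ invariantSubalgebra (Subgroup.closure s) ↔
      ∀ u ∈ s, linSubst (u : Matrix (Fin 2) (Fin 2) ℂ) P = P := by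
  rw [mem_invariantSubalgebra]
  refine ⟨fun h u hu => h u (Subgroup.subset_closure hu), fun h u hu => ?_⟩
  induction hu using Subgroup.closure_induction with
  | mem u hu => exact h u hu
  | one => exact linSubst_one P
  | mul u v _ _ hu hv => rw [Units.val_mul, linSubst_mul, hu, hv]
  | inv u _ hu =>
    conv_lhs => rw [← hu]
    rw [← linSubst_mul, Units.mul_inv, linSubst_one]

end LinSubst

section Icosahedral

/-- The order five generator of the binary icosahedral group. -/
def icosaRotation (ε : ℂ) : Matrix (Fin 2) (Fin 2) ℂ := !![ε ^ 3, 0; 0, ε ^ 2]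

/-- The order four generator of the binary icosahedral group, where `b` is a scaling factor. -/
def icosaReflection (ε b : ℂ) : Matrix (Fin 2) (Fin 2) ℂ :=
  !![(ε ^ 2 + ε ^ 3) * b, b; b, -((ε ^ 2 + ε ^ 3) * b)]

/-- Invariance under both generators of the binary icosahedral group. -/
def IsIcosaInvariant (ε b : ℂ) (P : MvPolynomial (Fin 2) ℂ) : Prop :=
  linSubst (icosaRotation ε) P = P ∧ linSubst (icosaReflection ε b) P = P

variable {ε b : ℂ} {P Q : MvPolynomial (Fin 2) ℂ}

theorem IsIcosaInvariant.mul (hP : IsIcosaInvariant ε b P) (hQ : IsIcosaInvariant ε b Q) :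
    IsIcosaInvariant ε b (P * Q) :=
  ⟨by rw [map_mul, hP.1, hQ.1], by rw [map_mul, hP.2, hQ.2]⟩

theorem IsIcosaInvariant.sub (hP : IsIcosaInvariant ε b P) (hQ : IsIcosaInvariant ε b Q) :
    IsIcosaInvariant ε b (P - Q) :=
  ⟨by rw [map_sub, hP.1, hQ.1], by rw [map_sub, hP.2, hQ.2]⟩

theorem IsIcosaInvariant.pow (hP : IsIcosaInvariant ε b P) (n : ℕ) :
    IsIcosaInvariant ε b (P ^ n) :=
  ⟨by rw [map_pow, hP.1], by rw [map_pow, hP.2]⟩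

theorem IsIcosaInvariant.const (c : ℂ) : IsIcosaInvariant ε b (C c) :=
  ⟨linSubst_C _ _, linSubst_C _ _⟩

theorem IsIcosaInvariant.of_mul (hP : IsIcosaInvariant ε b P) (hPQ : IsIcosaInvariant ε b (P * Q))
    (hP0 : P ≠ 0) : IsIcosaInvariant ε b Q := by
  obtain ⟨h1, h2⟩ := hPQ
  rw [map_mul, hP.1] at h1
  rw [map_mul, hP.2] at h2
  exact ⟨mul_left_cancel₀ hP0 h1, mul_left_cancel₀ hP0 h2⟩

theorem IsIcosaInvariant.homogeneousComponent (hP : IsIcosaInvariant ε b P) (n : ℕ) :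
    IsIcosaInvariant ε b (homogeneousComponent n P) :=
  ⟨by rw [← homogeneousComponent_linSubst, hP.1], by rw [← homogeneousComponent_linSubst, hP.2]⟩

theorem sum_pow_eq_zero_of_isPrimitiveRoot_five (hε : IsPrimitiveRoot ε 5) :
    1 + ε + ε ^ 2 + ε ^ 3 + ε ^ 4 = 0 := by
  have := hε.geom_sum_eq_zero (by norm_num)
  simpa [Finset.sum_range_succ] using this

theorem golden_of_isPrimitiveRoot_five (hε : IsPrimitiveRoot ε 5) :
    (ε ^ 2 + ε ^ 3) ^ 2 + (ε ^ 2 + ε ^ 3) = 1 := by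
  linear_combination (2 + ε) * hε.pow_eq_one + sum_pow_eq_zero_of_isPrimitiveRoot_five hε

theorem map_icosaVertexForm {R S : Type*} [CommRing R] [CommRing S] {F : Type*} [FunLike F R S]
    [RingHomClass F R S] (f : F) (x y : R) :
    f (icosaVertexForm x y) = icosaVertexForm (f x) (f y) := by
  simp [icosaVertexForm, map_ofNat f]

theorem map_icosaFaceForm {R S : Type*} [CommRing R] [CommRing S] {F : Type*} [FunLike F R S]
    [RingHomClass F R S] (f : F) (x y : R) :
    f (icosaFaceForm x y) = icosaFaceForm (f x) (f y) := by
  simp [icosaFaceForm, map_ofNat f]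

theorem map_icosaEdgeForm {R S : Type*} [CommRing R] [CommRing S] {F : Type*} [FunLike F R S]
    [RingHomClass F R S] (f : F) (x y : R) :
    f (icosaEdgeForm x y) = icosaEdgeForm (f x) (f y) := by
  simp [icosaEdgeForm, map_ofNat f]

theorem icosaVertexForm_rotate {R : Type*} [CommRing R] {e : R} (he : e ^ 5 = 1) (x y : R) :
    icosaVertexForm (e ^ 3 * x) (e ^ 2 * y) = icosaVertexForm x y := by
  calc _ = e ^ 5 * x * y * ((e ^ 5) ^ 6 * x ^ 10 + 11 * (e ^ 5) ^ 5 * x ^ 5 * y ^ 5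
        - (e ^ 5) ^ 4 * y ^ 10) := by unfold icosaVertexForm; ring
    _ = _ := by rw [he]; unfold icosaVertexForm; ring

theorem icosaFaceForm_rotate {R : Type*} [CommRing R] {e : R} (he : e ^ 5 = 1) (x y : R) :
    icosaFaceForm (e ^ 3 * x) (e ^ 2 * y) = icosaFaceForm x y := by
  calc _ = -((e ^ 5) ^ 12 * x ^ 20 + (e ^ 5) ^ 8 * y ^ 20)
        + 228 * ((e ^ 5) ^ 11 * x ^ 15 * y ^ 5 - (e ^ 5) ^ 9 * x ^ 5 * y ^ 15)
        - 494 * (e ^ 5) ^ 10 * x ^ 10 * y ^ 10 := by unfold icosaFaceForm; ring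
    _ = _ := by rw [he]; unfold icosaFaceForm; ring

theorem icosaEdgeForm_rotate {R : Type*} [CommRing R] {e : R} (he : e ^ 5 = 1) (x y : R) :
    icosaEdgeForm (e ^ 3 * x) (e ^ 2 * y) = icosaEdgeForm x y := by
  calc _ = (e ^ 5) ^ 18 * x ^ 30 + (e ^ 5) ^ 12 * y ^ 30
        + 522 * ((e ^ 5) ^ 17 * x ^ 25 * y ^ 5 - (e ^ 5) ^ 13 * x ^ 5 * y ^ 25)
        - 10005 * ((e ^ 5) ^ 16 * x ^ 20 * y ^ 10 + (e ^ 5) ^ 14 * x ^ 10 * y ^ 20) := by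
        unfold icosaEdgeForm; ring
    _ = _ := by rw [he]; unfold icosaEdgeForm; ring

theorem linSubst_icosaRotation_X_zero :
    linSubst (icosaRotation ε) (X 0) = C ε ^ 3 * X 0 := by
  simp [linSubst_X, icosaRotation]

theorem linSubst_icosaRotation_X_one :
    linSubst (icosaRotation ε) (X 1) = C ε ^ 2 * X 1 := by
  simp [linSubst_X, icosaRotation]

theorem linSubst_icosaReflection_X_zero :
    linSubst (icosaReflection ε b) (X 0) = C ((ε ^ 2 + ε ^ 3) * b) * X 0 + C b * X 1 := by
  simp [linSubst_X, icosaReflection]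

theorem linSubst_icosaReflection_X_one :
    linSubst (icosaReflection ε b) (X 1) = C b * X 0 - C ((ε ^ 2 + ε ^ 3) * b) * X 1 := by
  simp [linSubst_X, icosaReflection, sub_eq_add_neg]

variable (hε : IsPrimitiveRoot ε 5) (hb : b ^ 2 * (1 + (ε ^ 2 + ε ^ 3) ^ 2) = -1)

include hε in
theorem C_pow_five_eq_one : (C ε : MvPolynomial (Fin 2) ℂ) ^ 5 = 1 := by
  rw [← C_pow, hε.pow_eq_one, C_1]

theorem C_mul_reflection_entries :
    (C ((ε ^ 2 + ε ^ 3) * b) * C b : MvPolynomial (Fin 2) ℂ) = C ((ε ^ 2 + ε ^ 3) * b ^ 2) := by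
  rw [← C_mul]
  ring_nf

include hε in
theorem C_sq_sub_sq_reflection_entries :
    (C b ^ 2 - C ((ε ^ 2 + ε ^ 3) * b) ^ 2 : MvPolynomial (Fin 2) ℂ)
      = C ((ε ^ 2 + ε ^ 3) * b ^ 2) := by
  rw [← C_pow, ← C_pow, ← C_sub]
  congr 1
  linear_combination (-b ^ 2) * golden_of_isPrimitiveRoot_five hε

include hb in
theorem C_sq_add_sq_reflection_entries :
    (C ((ε ^ 2 + ε ^ 3) * b) ^ 2 + C b ^ 2 : MvPolynomial (Fin 2) ℂ) = -1 := by
  rw [← C_pow, ← C_pow, ← C_add, ← C_1, ← C_neg]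
  congr 1
  linear_combination hb

include hε hb in
theorem C_five_mul_sq_reflection_entries :
    (5 * C ((ε ^ 2 + ε ^ 3) * b ^ 2) ^ 2 : MvPolynomial (Fin 2) ℂ) = 1 := by
  have h5 : (5 : MvPolynomial (Fin 2) ℂ) = C 5 := (map_ofNat C 5).symm
  rw [h5, ← C_pow, ← C_mul, ← C_1]
  congr 1
  have h := golden_of_isPrimitiveRoot_five hε
  generalize ε ^ 2 + ε ^ 3 = t at h hb
  have h' : (1 + t ^ 2) ^ 2 = 5 * t ^ 2 := by linear_combination (t ^ 2 - t - 1) * h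
  linear_combination (b ^ 2 * (1 + t ^ 2) - 1) * hb - b ^ 4 * h'

include hε hb in
theorem isIcosaInvariant_icosaVertexForm :
    IsIcosaInvariant ε b (icosaVertexForm (X 0) (X 1)) := by
  constructor
  · rw [map_icosaVertexForm, linSubst_icosaRotation_X_zero, linSubst_icosaRotation_X_one,
      icosaVertexForm_rotate (C_pow_five_eq_one hε)]
  · rw [map_icosaVertexForm, linSubst_icosaReflection_X_zero, linSubst_icosaReflection_X_one,
      icosaVertexForm_reflect C_mul_reflection_entries (C_sq_sub_sq_reflection_entries hε)
        (C_five_mul_sq_reflection_entries hε hb)]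

include hε hb in
theorem isIcosaInvariant_icosaFaceForm :
    IsIcosaInvariant ε b (icosaFaceForm (X 0) (X 1)) := by
  constructor
  · rw [map_icosaFaceForm, linSubst_icosaRotation_X_zero, linSubst_icosaRotation_X_one,
      icosaFaceForm_rotate (C_pow_five_eq_one hε)]
  · rw [map_icosaFaceForm, linSubst_icosaReflection_X_zero, linSubst_icosaReflection_X_one,
      icosaFaceForm_reflect C_mul_reflection_entries (C_sq_sub_sq_reflection_entries hε)
        (C_five_mul_sq_reflection_entries hε hb)]

include hε hb in
theorem isIcosaInvariant_icosaEdgeForm :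
    IsIcosaInvariant ε b (icosaEdgeForm (X 0) (X 1)) := by
  constructor
  · rw [map_icosaEdgeForm, linSubst_icosaRotation_X_zero, linSubst_icosaRotation_X_one,
      icosaEdgeForm_rotate (C_pow_five_eq_one hε)]
  · rw [map_icosaEdgeForm, linSubst_icosaReflection_X_zero, linSubst_icosaReflection_X_one,
      icosaEdgeForm_reflect C_mul_reflection_entries (C_sq_sub_sq_reflection_entries hε)
        (C_sq_add_sq_reflection_entries hb) (C_five_mul_sq_reflection_entries hε hb)]

include hε hb in
theorem ten_dvd_of_eval_ne_zero {n : ℕ}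
    (hn : P.IsHomogeneous n) (hP : IsIcosaInvariant ε b P) (h0 : eval ![1, 0] P ≠ 0) :
    10 ∣ n := by
  have h5 : 5 ∣ n := by
    have h := eval_linSubst (icosaRotation ε) P ![1, 0]
    rw [hP.1, show (icosaRotation ε).mulVec ![1, 0] = ε ^ 3 • ![1, 0] by
      ext i
      fin_cases i <;> simp [icosaRotation], hn.eval_smul, ← pow_mul] at h
    have h1 : ε ^ (3 * n) = 1 := mul_right_cancel₀ h0 (by rw [← h, one_mul])
    exact (show Nat.Coprime 5 3 by norm_num).dvd_of_dvd_mul_left (hε.dvd_of_pow_eq_one _ h1)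
  have h2 : 2 ∣ n := by
    have h := eval_linSubst (icosaReflection ε b * icosaReflection ε b) P ![1, 0]
    rw [linSubst_mul, hP.2, hP.2, show (icosaReflection ε b * icosaReflection ε b).mulVec ![1, 0]
      = (-1 : ℂ) • ![1, 0] by
        have : (ε ^ 2 + ε ^ 3) * b * ((ε ^ 2 + ε ^ 3) * b) + b * b = -1 := by
          linear_combination hb
        ext i
        fin_cases i
        · simpa [icosaReflection, Matrix.mul_apply, Fin.sum_univ_two] using this
        · simp [icosaReflection]
          ring, hn.eval_smul] at h
    have h1 : (-1 : ℂ) ^ n = 1 := mul_right_cancel₀ h0 (by rw [← h, one_mul])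
    exact even_iff_two_dvd.1 ((neg_one_pow_eq_one_iff_even (by norm_num)).1 h1)
  omega

theorem icosaVertexForm_eq_prod {K : Type*} [Field K] {t : K} (ht : t ^ 2 + t = 1) :
    (icosaVertexForm (X 0) (X 1) : MvPolynomial (Fin 2) K) =
      X 0 * (X 1 * ((X 0 ^ 5 - C (t ^ 5) * X 1 ^ 5) *
        (X 0 ^ 5 - C ((-(t + 1)) ^ 5) * X 1 ^ 5))) := by
  have h1 : t ^ 5 = 5 * t - 3 := by linear_combination (t ^ 3 - t ^ 2 + 2 * t - 3) * ht
  have h2 : (-(t + 1)) ^ 5 = -(5 * t) - 8 := by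
    linear_combination (-t ^ 3 - 4 * t ^ 2 - 7 * t - 7) * ht
  have hC : (C t ^ 2 + C t : MvPolynomial (Fin 2) K) = 1 := by rw [← C_pow, ← C_add, ht, C_1]
  have h3 : (C (t ^ 5) : MvPolynomial (Fin 2) K) = 5 * C t - 3 := by
    rw [h1]
    simp [map_ofNat C]
  have h4 : (C ((-(t + 1)) ^ 5) : MvPolynomial (Fin 2) K) = -(5 * C t) - 8 := by
    rw [h2]
    simp [map_ofNat C]
  rw [h3, h4]
  unfold icosaVertexForm
  linear_combination (25 * X 0 * X 1 ^ 11) * hC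

include hε in
theorem icosaVertexForm_dvd (hb0 : b ≠ 0) (hP : IsIcosaInvariant ε b P)
    (h : (X 1 : MvPolynomial (Fin 2) ℂ) ∣ P) :
    (icosaVertexForm (X 0) (X 1) : MvPolynomial (Fin 2) ℂ) ∣ P := by
  have ht := golden_of_isPrimitiveRoot_five hε
  have hε4 : IsPrimitiveRoot (ε ^ 4) 5 := hε.pow_of_coprime 4 (by norm_num)
  set t := ε ^ 2 + ε ^ 3 with ht_def
  have hrot : ∀ c : ℂ, (X 0 - C c * X 1 : MvPolynomial (Fin 2) ℂ) ∣ P →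
      ∀ k : ℕ, (X 0 - C ((ε ^ 4) ^ k * c) * X 1 : MvPolynomial (Fin 2) ℂ) ∣ P := by
    intro c hc k
    induction k with
    | zero => simpa using hc
    | succ k ih =>
      have h1 := map_dvd (linSubst (icosaRotation ε)) ih
      have hu : IsUnit (C ε ^ 3 : MvPolynomial (Fin 2) ℂ) :=
        ((isUnit_iff_ne_zero.2 (hε.ne_zero (by norm_num))).map C).pow 3
      rw [hP.1, map_sub, map_mul, linSubst_C, linSubst_icosaRotation_X_zero,
        linSubst_icosaRotation_X_one, show (C ε ^ 3 * X 0 - C ((ε ^ 4) ^ k * c) * (C ε ^ 2 * X 1) :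
          MvPolynomial (Fin 2) ℂ) = C ε ^ 3 * (X 0 - C ((ε ^ 4) ^ (k + 1) * c) * X 1) by
            simp only [C_mul, C_pow]
            linear_combination (C ε ^ 2 * (C ε ^ 4) ^ k * C c * X 1) * C_pow_five_eq_one hε] at h1
      exact (hu.mul_left_dvd).1 h1
  have hrefl : ∀ c c' : ℂ, c ≠ t → c' * (c - t) = 1 + c * t →
      (X 0 - C c * X 1 : MvPolynomial (Fin 2) ℂ) ∣ P →
      (X 0 - C c' * X 1 : MvPolynomial (Fin 2) ℂ) ∣ P := by
    intro c c' hc hcc' hd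
    have h1 := map_dvd (linSubst (icosaReflection ε b)) hd
    have hu : IsUnit (C (b * (t - c)) : MvPolynomial (Fin 2) ℂ) :=
      (isUnit_iff_ne_zero.2 (mul_ne_zero hb0 (sub_ne_zero.2 hc.symm))).map C
    have hC : (C c' * (C c - C t) : MvPolynomial (Fin 2) ℂ) = 1 + C c * C t := by
      rw [← C_sub, ← C_mul, hcc', C_add, C_mul, C_1]
    rw [hP.2, map_sub, map_mul, linSubst_C, linSubst_icosaReflection_X_zero,
      linSubst_icosaReflection_X_one, ← ht_def, show (C (t * b) * X 0 + C b * X 1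
        - C c * (C b * X 0 - C (t * b) * X 1) : MvPolynomial (Fin 2) ℂ)
        = C (b * (t - c)) * (X 0 - C c' * X 1) by
          simp only [C_mul, C_sub]
          linear_combination (-C b * X 1) * hC] at h1
    exact (hu.mul_left_dvd).1 h1
  have hCb : IsUnit (C b : MvPolynomial (Fin 2) ℂ) := (isUnit_iff_ne_zero.2 hb0).map C
  have ht0 : t ≠ 0 := by
    rintro h0
    norm_num [h0] at ht
  have ht1 : -(t + 1) ≠ 0 := by
    intro h0
    rw [show t = -1 by linear_combination -h0] at ht
    norm_num at ht
  have hupper : (X 0 - C t * X 1 : MvPolynomial (Fin 2) ℂ) ∣ P := by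
    have h1 := map_dvd (linSubst (icosaReflection ε b)) h
    rw [hP.2, linSubst_icosaReflection_X_one, ← ht_def, show (C b * X 0 - C (t * b) * X 1 :
      MvPolynomial (Fin 2) ℂ) = C b * (X 0 - C t * X 1) by rw [C_mul]; ring] at h1
    exact (hCb.mul_left_dvd).1 h1
  have hlower : (X 0 - C (-(t + 1)) * X 1 : MvPolynomial (Fin 2) ℂ) ∣ P := by
    have h1 := hrot t hupper 3
    have hne : (ε ^ 4) ^ 3 * t ≠ t := by
      intro h0
      have : (ε ^ 4) ^ 3 = 1 := mul_right_cancel₀ ht0 (by rw [h0, one_mul])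
      have := hε4.dvd_of_pow_eq_one 3 this
      omega
    have h2 := hrot _ (hrefl _ (-(ε ^ 2 * (t + 1))) hne (by
      rw [show (ε ^ 4) ^ 3 = ε ^ 2 by linear_combination (ε ^ 7 + ε ^ 2) * hε.pow_eq_one]
      linear_combination (-ε ^ 4) * ht + ε ^ 2 * ht_def + hε.pow_eq_one) h1) 2
    rwa [show (ε ^ 4) ^ 2 * -(ε ^ 2 * (t + 1)) = -(t + 1) by
      linear_combination (-(ε ^ 5 + 1) * (t + 1)) * hε.pow_eq_one] at h2
  have hzero : (X 0 : MvPolynomial (Fin 2) ℂ) ∣ P := by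
    have hne : -(t + 1) ≠ t := by
      intro h0
      rw [show t = -1 / 2 by linear_combination -h0 / 2] at ht
      norm_num at ht
    have := hrefl _ 0 hne (by linear_combination ht) hlower
    rwa [C_0, zero_mul, sub_zero] at this
  have hA := pow_sub_C_mul_pow_dvd (by norm_num) hε4 ht0 (hrot _ hupper)
  have hB := pow_sub_C_mul_pow_dvd (by norm_num) hε4 ht1 (hrot _ hlower)
  have hne : t ^ 5 ≠ (-(t + 1)) ^ 5 := by
    intro h0
    have h1 : 10 * t + 5 = 0 := by
      linear_combination h0 + (-(t ^ 3 - t ^ 2 + 2 * t - 3) + (-t ^ 3 - 4 * t ^ 2 - 7 * t - 7)) * ht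
    rw [show t = -1 / 2 by linear_combination h1 / 10] at ht
    norm_num at ht
  rw [icosaVertexForm_eq_prod ht]
  exact (isRelPrime_X_zero_X_one.mul_right
    ((isRelPrime_X_zero_pow_sub (pow_ne_zero _ ht0) 4).mul_right
    (isRelPrime_X_zero_pow_sub (pow_ne_zero _ ht1) 4))).mul_dvd hzero
    (((isRelPrime_X_one_pow_sub _ 4).mul_right (isRelPrime_X_one_pow_sub _ 4)).mul_dvd h
      ((isRelPrime_X_sub_C_mul_X hne 5).mul_dvd hA hB))

theorem isHomogeneous_icosaVertexForm {R : Type*} [CommRing R] :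
    (icosaVertexForm (X 0) (X 1) : MvPolynomial (Fin 2) R).IsHomogeneous 12 := by
  have h (i j : ℕ) : (X 0 ^ i * X 1 ^ j : MvPolynomial (Fin 2) R).IsHomogeneous (i + j) :=
    (isHomogeneous_X_pow 0 i).mul (isHomogeneous_X_pow 1 j)
  rw [show (icosaVertexForm (X 0) (X 1) : MvPolynomial (Fin 2) R) =
    X 0 ^ 11 * X 1 ^ 1 + C 11 * (X 0 ^ 6 * X 1 ^ 6) - X 0 ^ 1 * X 1 ^ 11 by
      rw [map_ofNat C]; unfold icosaVertexForm; ring]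
  exact ((h 11 1).add ((h 6 6).C_mul 11)).sub (h 1 11)

theorem isHomogeneous_icosaFaceForm {R : Type*} [CommRing R] :
    (icosaFaceForm (X 0) (X 1) : MvPolynomial (Fin 2) R).IsHomogeneous 20 := by
  have h (i j : ℕ) : (X 0 ^ i * X 1 ^ j : MvPolynomial (Fin 2) R).IsHomogeneous (i + j) :=
    (isHomogeneous_X_pow 0 i).mul (isHomogeneous_X_pow 1 j)
  rw [show (icosaFaceForm (X 0) (X 1) : MvPolynomial (Fin 2) R) =
    -(X 0 ^ 20 * X 1 ^ 0 + X 0 ^ 0 * X 1 ^ 20) + C 228 * (X 0 ^ 15 * X 1 ^ 5 - X 0 ^ 5 * X 1 ^ 15)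
      - C 494 * (X 0 ^ 10 * X 1 ^ 10) by
      rw [map_ofNat C, map_ofNat C]; unfold icosaFaceForm; ring]
  exact (((h 20 0).add (h 0 20)).neg.add (((h 15 5).sub (h 5 15)).C_mul 228)).sub
    ((h 10 10).C_mul 494)

theorem isHomogeneous_icosaEdgeForm {R : Type*} [CommRing R] :
    (icosaEdgeForm (X 0) (X 1) : MvPolynomial (Fin 2) R).IsHomogeneous 30 := by
  have h (i j : ℕ) : (X 0 ^ i * X 1 ^ j : MvPolynomial (Fin 2) R).IsHomogeneous (i + j) :=
    (isHomogeneous_X_pow 0 i).mul (isHomogeneous_X_pow 1 j)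
  rw [show (icosaEdgeForm (X 0) (X 1) : MvPolynomial (Fin 2) R) =
    X 0 ^ 30 * X 1 ^ 0 + X 0 ^ 0 * X 1 ^ 30 + C 522 * (X 0 ^ 25 * X 1 ^ 5 - X 0 ^ 5 * X 1 ^ 25)
      - C 10005 * (X 0 ^ 20 * X 1 ^ 10 + X 0 ^ 10 * X 1 ^ 20) by
      rw [map_ofNat C, map_ofNat C]; unfold icosaEdgeForm; ring]
  exact (((h 30 0).add (h 0 30)).add (((h 25 5).sub (h 5 25)).C_mul 522)).sub
    (((h 20 10).add (h 10 20)).C_mul 10005)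

theorem eval_icosaVertexForm {R : Type*} [CommRing R] (v : Fin 2 → R) :
    eval v (icosaVertexForm (X 0) (X 1)) = icosaVertexForm (v 0) (v 1) := by
  rw [map_icosaVertexForm, eval_X, eval_X]

theorem eval_icosaEdgeForm {R : Type*} [CommRing R] (v : Fin 2 → R) :
    eval v (icosaEdgeForm (X 0) (X 1)) = icosaEdgeForm (v 0) (v 1) := by
  rw [map_icosaEdgeForm, eval_X, eval_X]

theorem icosaVertexForm_ne_zero :
    (icosaVertexForm (X 0) (X 1) : MvPolynomial (Fin 2) ℂ) ≠ 0 := by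
  intro h
  have := eval_icosaVertexForm (R := ℂ) ![1, 1]
  rw [h] at this
  norm_num [icosaVertexForm] at this

theorem icosaEdgeForm_ne_zero :
    (icosaEdgeForm (X 0) (X 1) : MvPolynomial (Fin 2) ℂ) ≠ 0 := by
  intro h
  have := eval_icosaEdgeForm (R := ℂ) ![1, 0]
  rw [h] at this
  norm_num [icosaEdgeForm] at this

include hε hb in
theorem exists_eq_icosaVertexForm_mul {n : ℕ} (hn : P.IsHomogeneous n)
    (hP : IsIcosaInvariant ε b P) (h0 : eval ![1, 0] P = 0) :
    P = 0 ∨ 12 ≤ n ∧ ∃ Q : MvPolynomial (Fin 2) ℂ, Q.IsHomogeneous (n - 12) ∧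
      IsIcosaInvariant ε b Q ∧ P = icosaVertexForm (X 0) (X 1) * Q := by
  have hb0 : b ≠ 0 := by
    rintro rfl
    norm_num at hb
  refine (hn.exists_of_dvd isHomogeneous_icosaVertexForm
    (icosaVertexForm_dvd hε hb0 hP (hn.X_one_dvd h0))).imp_right ?_
  rintro ⟨h12, Q, hQ, rfl⟩
  exact ⟨h12, Q, hQ, (isIcosaInvariant_icosaVertexForm hε hb).of_mul hP icosaVertexForm_ne_zero,
    rfl⟩

include hε hb in
theorem IsIcosaInvariant.eq_zero_of_not_ten_dvd {n : ℕ} (hn : P.IsHomogeneous n)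
    (hP : IsIcosaInvariant ε b P) (h10 : ¬ 10 ∣ n) (hlt : n < 12) : P = 0 := by
  rcases exists_eq_icosaVertexForm_mul hε hb hn hP
    (not_not.1 fun h => h10 (ten_dvd_of_eval_ne_zero hε hb hn hP h)) with h | ⟨h, -⟩
  · exact h
  · omega

include hε hb in
theorem IsIcosaInvariant.eval_eq_zero_of_degree_ten (hn : P.IsHomogeneous 10)
    (hP : IsIcosaInvariant ε b P) : eval ![1, 0] P = 0 := by
  by_contra hc
  set c := eval ![1, 0] P with hc_def
  have hsq : P ^ 2 = C (-c ^ 2) * icosaFaceForm (X 0) (X 1) := by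
    rw [← sub_eq_zero]
    rcases exists_eq_icosaVertexForm_mul hε hb
      ((hn.pow 2).sub (isHomogeneous_icosaFaceForm.C_mul (-c ^ 2)))
      ((hP.pow 2).sub ((const _).mul (isIcosaInvariant_icosaFaceForm hε hb)))
      (by simp [icosaFaceForm, ← hc_def]) with h | ⟨-, Q, hQn, hQ, h⟩
    · exact h
    · rw [h, hQ.eq_zero_of_not_ten_dvd hε hb hQn (by norm_num) (by norm_num), mul_zero]
  have hcube : P ^ 3 = C (c ^ 3) * icosaEdgeForm (X 0) (X 1) := by
    rw [← sub_eq_zero]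
    rcases exists_eq_icosaVertexForm_mul hε hb
      ((hn.pow 3).sub (isHomogeneous_icosaEdgeForm.C_mul (c ^ 3)))
      ((hP.pow 3).sub ((const _).mul (isIcosaInvariant_icosaEdgeForm hε hb)))
      (by simp [icosaEdgeForm, ← hc_def]) with h | ⟨-, Q, hQn, hQ, h⟩
    · exact h
    · rcases exists_eq_icosaVertexForm_mul hε hb hQn hQ (not_not.1 fun h =>
        absurd (ten_dvd_of_eval_ne_zero hε hb hQn hQ h) (by norm_num))
        with h' | ⟨-, Q', hQn', hQ', h'⟩
      · rw [h, h', mul_zero]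
      · rw [h, h', hQ'.eq_zero_of_not_ten_dvd hε hb hQn' (by norm_num) (by norm_num), mul_zero,
          mul_zero]
  have hsyz := icosaForms_syzygy (X 0 : MvPolynomial (Fin 2) ℂ) (X 1)
  have hzero : C c ^ 6 * (1728 * icosaVertexForm (X 0) (X 1) ^ 5 : MvPolynomial (Fin 2) ℂ) = 0 := by
    rw [← hsyz]
    calc (C c ^ 6 * (icosaEdgeForm (X 0) (X 1) ^ 2 + icosaFaceForm (X 0) (X 1) ^ 3) :
          MvPolynomial (Fin 2) ℂ)
        = (C (c ^ 3) * icosaEdgeForm (X 0) (X 1)) ^ 2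
          - (C (-c ^ 2) * icosaFaceForm (X 0) (X 1)) ^ 3 := by
          simp only [C_pow, C_neg]
          ring
      _ = 0 := by rw [← hsq, ← hcube]; ring
  have hC : (C c : MvPolynomial (Fin 2) ℂ) ≠ 0 := by rwa [Ne, C_eq_zero]
  exact mul_ne_zero (pow_ne_zero _ hC)
    (mul_ne_zero (by norm_num) (pow_ne_zero _ icosaVertexForm_ne_zero)) hzero

include hε hb in
theorem IsIcosaInvariant.mem_of_isHomogeneous {A : Subalgebra ℂ (MvPolynomial (Fin 2) ℂ)}
    (hV : icosaVertexForm (X 0) (X 1) ∈ A) (hF : icosaFaceForm (X 0) (X 1) ∈ A)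
    (hE : icosaEdgeForm (X 0) (X 1) ∈ A) {n : ℕ} (hn : P.IsHomogeneous n)
    (hP : IsIcosaInvariant ε b P) : P ∈ A := by
  induction n using Nat.strong_induction_on generalizing P with
  | _ n ih =>
  have hmem : ∀ {R : MvPolynomial (Fin 2) ℂ}, R.IsHomogeneous n → IsIcosaInvariant ε b R →
      eval ![1, 0] R = 0 → R ∈ A := by
    intro R hRn hR hR0
    rcases exists_eq_icosaVertexForm_mul hε hb hRn hR hR0 with rfl | ⟨h12, Q, hQn, hQ, rfl⟩
    · exact A.zero_mem
    · exact A.mul_mem hV (ih _ (by omega) hQn hQ)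
  by_cases h0 : eval ![1, 0] P = 0
  · exact hmem hn hP h0
  obtain ⟨m, rfl⟩ := ten_dvd_of_eval_ne_zero hε hb hn hP h0
  obtain rfl | rfl | hm : m = 0 ∨ m = 1 ∨ 2 ≤ m := by omega
  · rw [totalDegree_eq_zero_iff_eq_C.1 (Nat.le_zero.1 hn.totalDegree_le)]
    exact A.algebraMap_mem _
  · exact absurd (hP.eval_eq_zero_of_degree_ten hε hb hn) h0
  obtain ⟨i, j, hij⟩ : ∃ i j, m = 2 * i + 3 * j := by
    rcases Nat.even_or_odd' m with ⟨k, hk | hk⟩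
    · exact ⟨k, 0, by omega⟩
    · exact ⟨k - 1, 1, by omega⟩
  let M : MvPolynomial (Fin 2) ℂ := C (eval ![1, 0] P * (-1) ^ i) *
    (icosaFaceForm (X 0) (X 1) ^ i * icosaEdgeForm (X 0) (X 1) ^ j)
  have hMA : M ∈ A := A.mul_mem (A.algebraMap_mem _) (A.mul_mem (A.pow_mem hF i) (A.pow_mem hE j))
  have hMn : M.IsHomogeneous (10 * m) := by
    have := ((isHomogeneous_icosaFaceForm (R := ℂ)).pow i).mul
      ((isHomogeneous_icosaEdgeForm (R := ℂ)).pow j)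
    rw [show 20 * i + 30 * j = 10 * m by omega] at this
    exact this.C_mul _
  have hM : IsIcosaInvariant ε b M := (const _).mul
    (((isIcosaInvariant_icosaFaceForm hε hb).pow i).mul
      ((isIcosaInvariant_icosaEdgeForm hε hb).pow j))
  have hM0 : eval ![1, 0] M = eval ![1, 0] P := by
    simp [M, icosaFaceForm, icosaEdgeForm, mul_assoc, ← mul_pow]
  rw [← sub_add_cancel P M]
  exact A.add_mem (hmem (hn.sub hMn) (hP.sub hM) (by rw [map_sub, hM0, sub_self])) hMA

include hε hb in
theorem IsIcosaInvariant.mem {A : Subalgebra ℂ (MvPolynomial (Fin 2) ℂ)}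
    (hV : icosaVertexForm (X 0) (X 1) ∈ A) (hF : icosaFaceForm (X 0) (X 1) ∈ A)
    (hE : icosaEdgeForm (X 0) (X 1) ∈ A) (hP : IsIcosaInvariant ε b P) : P ∈ A := by
  rw [← sum_homogeneousComponent P]
  exact A.sum_mem fun n _ => (hP.homogeneousComponent n).mem_of_isHomogeneous hε hb hV hF hE
    (homogeneousComponent_isHomogeneous n P)

include hε hb in
theorem mem_range_aeval_iff_isIcosaInvariant {c : ℂ} (hc : c ≠ 0) :
    P ∈ (aeval ![icosaEdgeForm (X 0) (X 1), icosaFaceForm (X 0) (X 1),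
      C c * icosaVertexForm (X 0) (X 1)] :
        MvPolynomial (Fin 3) ℂ →ₐ[ℂ] MvPolynomial (Fin 2) ℂ).range ↔ IsIcosaInvariant ε b P := by
  have hI := (IsIcosaInvariant.const (ε := ε) (b := b) c).mul
    (isIcosaInvariant_icosaVertexForm hε hb)
  have hE := isIcosaInvariant_icosaEdgeForm hε hb
  have hF := isIcosaInvariant_icosaFaceForm hε hb
  constructor
  · rintro ⟨Q, rfl⟩
    constructor
    · refine AlgHom.congr_fun (φ₁ := (linSubst _).comp (aeval _))
        (MvPolynomial.algHom_ext fun i => ?_) Q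
      fin_cases i <;> simp only [AlgHom.comp_apply, aeval_X]
      exacts [hE.1, hF.1, hI.1]
    · refine AlgHom.congr_fun (φ₁ := (linSubst _).comp (aeval _))
        (MvPolynomial.algHom_ext fun i => ?_) Q
      fin_cases i <;> simp only [AlgHom.comp_apply, aeval_X]
      exacts [hE.2, hF.2, hI.2]
  · refine fun hP => hP.mem hε hb ⟨C c⁻¹ * X 2, ?_⟩ ⟨X 1, by simp⟩ ⟨X 0, by simp⟩
    simp [← mul_assoc, algebraMap_eq, ← C_mul, inv_mul_cancel₀ hc]

theorem ker_aeval_icosaForms {c : ℂ} (hc : c ^ 5 = -1728) :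
    RingHom.ker (aeval ![icosaEdgeForm (X 0) (X 1), icosaFaceForm (X 0) (X 1),
      C c * icosaVertexForm (X 0) (X 1)] :
        MvPolynomial (Fin 3) ℂ →ₐ[ℂ] MvPolynomial (Fin 2) ℂ) =
      Ideal.span {(X 0 ^ 2 + X 1 ^ 3 + X 2 ^ 5 : MvPolynomial (Fin 3) ℂ)} := by
  have hc0 : c ≠ 0 := by
    rintro rfl
    norm_num at hc
  have hC : (C c : MvPolynomial (Fin 2) ℂ) ^ 5 = -1728 := by
    rw [← C_pow, hc, C_neg, map_ofNat C]
  have hI : (C Complex.I : MvPolynomial (Fin 2) ℂ) ^ 2 = -1 := by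
    rw [← C_pow, Complex.I_sq, C_neg, C_1]
  have hX (i : Fin 2) : linSubst (Complex.I • 1) (X i) = C Complex.I * X i := by
    fin_cases i <;> simp [linSubst_X]
  refine ker_aeval_eq_span_brieskorn icosaEdgeForm_ne_zero
    (algebraicIndependent_of_surjective_on_axis
      (mul_ne_zero (by rwa [Ne, C_eq_zero]) icosaVertexForm_ne_zero) (fun x => ?_) fun s => ?_)
    ?_ (linSubst (Complex.I • 1)) ?_ ?_ ?_
  · simp [icosaVertexForm]
  · obtain ⟨x, hx⟩ := IsAlgClosed.exists_pow_nat_eq (-s) (show 0 < 20 by norm_num)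
    exact ⟨x, by simp [icosaFaceForm, hx]⟩
  · rw [icosaForms_syzygy, mul_pow, hC]
    ring
  · rw [map_icosaEdgeForm, hX, hX]
    generalize (C Complex.I : MvPolynomial (Fin 2) ℂ) = e at hI
    calc _ = (e ^ 2) ^ 15 * icosaEdgeForm (X 0) (X 1) := by unfold icosaEdgeForm; ring
      _ = _ := by rw [hI]; ring
  · rw [map_icosaFaceForm, hX, hX]
    generalize (C Complex.I : MvPolynomial (Fin 2) ℂ) = e at hI
    calc _ = (e ^ 2) ^ 10 * icosaFaceForm (X 0) (X 1) := by unfold icosaFaceForm; ring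
      _ = _ := by rw [hI]; ring
  · rw [map_mul, linSubst_C, map_icosaVertexForm, hX, hX]
    generalize (C Complex.I : MvPolynomial (Fin 2) ℂ) = e at hI
    calc _ = C c * ((e ^ 2) ^ 6 * icosaVertexForm (X 0) (X 1)) := by unfold icosaVertexForm; ring
      _ = _ := by rw [hI]; ring

include hε hb in
theorem mem_invariantSubalgebra_closure_iff_isIcosaInvariant :
    P ∈ invariantSubalgebra (Subgroup.closure {u : (Matrix (Fin 2) (Fin 2) ℂ)ˣ |
      (u : Matrix (Fin 2) (Fin 2) ℂ) = icosaRotation ε ∨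
      (u : Matrix (Fin 2) (Fin 2) ℂ) = icosaReflection ε b}) ↔ IsIcosaInvariant ε b P := by
  have hdet1 : (icosaRotation ε).det = 1 := by
    rw [icosaRotation, Matrix.det_fin_two_of]
    linear_combination hε.pow_eq_one
  have hdet2 : (icosaReflection ε b).det = 1 := by
    rw [icosaReflection, Matrix.det_fin_two_of]
    linear_combination -hb
  have h1 : IsUnit (icosaRotation ε) := by
    rw [Matrix.isUnit_iff_isUnit_det, hdet1]
    exact isUnit_one
  have h2 : IsUnit (icosaReflection ε b) := by
    rw [Matrix.isUnit_iff_isUnit_det, hdet2]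
    exact isUnit_one
  rw [mem_invariantSubalgebra_closure]
  constructor
  · intro h
    obtain ⟨u, hu⟩ := h1
    obtain ⟨v, hv⟩ := h2
    have hPu := h u (Or.inl hu)
    have hPv := h v (Or.inr hv)
    rw [hu] at hPu
    rw [hv] at hPv
    exact ⟨hPu, hPv⟩
  · intro hP u hu
    rw [Set.mem_ofPred_eq] at hu
    rcases hu with hu | hu
    · rw [hu]
      exact hP.1
    · rw [hu]
      exact hP.2

end Icosahedral

/-- Klein's theorem.  Let `ε = exp(2πi/5)` and let `2I ⊂ SL₂(ℂ)` be the binary icosahedral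
group `Δ'(2,3,5)` generated by `S = [[ε³,0],[0,ε²]]` and
`T = (1/√5)[[−(ε−ε⁴), ε²−ε³],[ε²−ε³, ε−ε⁴]]`, acting on `ℂ[x,y]` by linear substitution.
Then the invariant subalgebra `ℂ[x,y]^{2I}` is isomorphic as a ℂ-algebra to
`ℂ[z₁,z₂,z₃]/(z₁² + z₂³ + z₃⁵)`, the coordinate ring of the Brieskorn variety `V(2,3,5)`.
Hence `V(2,3,5) ≅ ℂ²/Δ'(2,3,5)`. -/
theorem brieskorn_V235_iso_C2_mod_binaryIcosahedral
    (ε : ℂ) (hε : ε = Complex.exp (2 * Real.pi * Complex.I / 5))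
    (I2 : Subgroup (Matrix (Fin 2) (Fin 2) ℂ)ˣ)
    (hI2 : I2 = Subgroup.closure
      {u : (Matrix (Fin 2) (Fin 2) ℂ)ˣ |
        (u : Matrix (Fin 2) (Fin 2) ℂ) = !![ε ^ 3, 0; 0, ε ^ 2] ∨
        (u : Matrix (Fin 2) (Fin 2) ℂ) =
          ((Real.sqrt 5 : ℂ))⁻¹ •
            !![-(ε - ε ^ 4), ε ^ 2 - ε ^ 3; ε ^ 2 - ε ^ 3, ε - ε ^ 4]}) :
    Nonempty
      (invariantSubalgebra I2 ≃ₐ[ℂ]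
        (MvPolynomial (Fin 3) ℂ ⧸
          Ideal.span {(X 0 ^ 2 + X 1 ^ 3 + X 2 ^ 5 : MvPolynomial (Fin 3) ℂ)})) := by
  have hprim : IsPrimitiveRoot ε 5 := by
    rw [hε]
    exact_mod_cast Complex.isPrimitiveRoot_exp 5 (by norm_num)
  have h5 := hprim.pow_eq_one
  have hsum := sum_pow_eq_zero_of_isPrimitiveRoot_five hprim
  have hsqrt : 5 * ((Real.sqrt 5 : ℂ)⁻¹) ^ 2 = 1 := by
    have : (Real.sqrt 5 : ℂ) ^ 2 = 5 := by
      rw [← Complex.ofReal_pow, Real.sq_sqrt (by norm_num)]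
      norm_num
    rw [inv_pow, this]
    norm_num
  generalize ((Real.sqrt 5 : ℂ))⁻¹ = r at hsqrt hI2
  set b : ℂ := r * (ε ^ 2 - ε ^ 3) with hb_def
  have hb : b ^ 2 * (1 + (ε ^ 2 + ε ^ 3) ^ 2) = -1 := by
    have h : (ε ^ 2 - ε ^ 3) ^ 2 * (1 + (ε ^ 2 + ε ^ 3) ^ 2) = -5 := by
      have ht := golden_of_isPrimitiveRoot_five hprim
      have h1 : (ε ^ 2 - ε ^ 3) ^ 2 = -3 - (ε ^ 2 + ε ^ 3) := by
        linear_combination (ε - 2) * h5 + hsum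
      rw [h1]
      linear_combination (-2 - (ε ^ 2 + ε ^ 3)) * ht
    rw [hb_def]
    linear_combination r ^ 2 * h - hsqrt
  have hT : r • !![-(ε - ε ^ 4), ε ^ 2 - ε ^ 3; ε ^ 2 - ε ^ 3, ε - ε ^ 4] =
      icosaReflection ε b := by
    have h : (ε ^ 2 + ε ^ 3) * b = r * -(ε - ε ^ 4) := by
      rw [hb_def]
      linear_combination (-r * ε) * h5
    rw [icosaReflection, h, Matrix.smul_of]
    simp [hb_def]
    ring
  obtain ⟨c, hc⟩ := IsAlgClosed.exists_pow_nat_eq (-1728 : ℂ) (show 0 < 5 by norm_num)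
  have hc0 : c ≠ 0 := by
    rintro rfl
    norm_num at hc
  have hrange : invariantSubalgebra I2 = (aeval ![icosaEdgeForm (X 0) (X 1),
      icosaFaceForm (X 0) (X 1), C c * icosaVertexForm (X 0) (X 1)] :
        MvPolynomial (Fin 3) ℂ →ₐ[ℂ] MvPolynomial (Fin 2) ℂ).range := by
    ext P
    rw [mem_range_aeval_iff_isIcosaInvariant hprim hb hc0, hI2, hT]
    exact mem_invariantSubalgebra_closure_iff_isIcosaInvariant hprim hb
  rw [← ker_aeval_icosaForms hc, ← AlgHom.ker_rangeRestrict, hrange]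
  exact ⟨(Ideal.quotientKerAlgEquivOfSurjective (AlgHom.rangeRestrict_surjective _)).symm⟩
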